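/- arXiv:1706.02202 — 10 statements merged into one kernel-verified Lean document; each statement's English description precedes it below -/
import Mathlib

section
/- Consider n coupled tasks with first sub-task of processing time a, idle time L = a + b, and second sub-task of processing time b, where a, b are natural numbers with 0 < b < a. In any valid schedule, for every task i, at most two sub-task intervals of other tasks are contained in the idle interval [σ(i)+a, σ(i)+a+L) of task i. -/
/-- The time interval occupied by a sub-task of a coupled task: `(i, true)` denotes the
first sub-task of task `i` (processing time `a`), `(i, false)` the second sub-task
(processing time `b`), which starts `L` time units after the completion of the first one. -/
def taskInterval (n a b L : ℕ) (σ : Fin n → ℕ) (q : Fin n × Bool) : Set ℕ :=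
  if q.2 then Set.Ico (σ q.1) (σ q.1 + a)
  else Set.Ico (σ q.1 + a + L) (σ q.1 + a + L + b)

/-- A schedule is valid when the `2n` sub-task intervals are pairwise disjoint. -/
def ValidSchedule (n a b L : ℕ) (σ : Fin n → ℕ) : Prop :=
  Pairwise fun q r : Fin n × Bool =>
    Disjoint (taskInterval n a b L σ q) (taskInterval n a b L σ r)

theorem ico_sep {x y u v : ℕ} (hu : 0 < u) (hv : 0 < v)
    (h : Disjoint (Set.Ico x (x + u)) (Set.Ico y (y + v))) : x + u ≤ y ∨ y + v ≤ x := by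
  by_contra hc
  push Not at hc
  have hd := Set.disjoint_left.1 h
  exact @hd (max x y)
    (by simp only [Set.mem_Ico]; omega) (by simp only [Set.mem_Ico]; omega)

theorem ico_sub {x u c d : ℕ} (hu : 0 < u)
    (h : Set.Ico x (x + u) ⊆ Set.Ico c d) : c ≤ x ∧ x + u ≤ d := by
  have h1 := h (a := x) (by simp only [Set.mem_Ico]; omega)
  have h2 := h (a := x + u - 1) (by simp only [Set.mem_Ico]; omega)
  simp only [Set.mem_Ico] at h1 h2
  omega

/-- with `0 < b < a` and `L = a + b`, in any valid schedule at most two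
sub-task intervals of other tasks are contained in the idle interval
`[σ i + a, σ i + a + L)` of any task `i`. -/
theorem stmt_0 (n a b : ℕ) (hb : 0 < b) (hba : b < a)
    (σ : Fin n → ℕ) (hσ : ValidSchedule n a b (a + b) σ) (i : Fin n) :
    {q : Fin n × Bool | q.1 ≠ i ∧
      taskInterval n a b (a + b) σ q ⊆ Set.Ico (σ i + a) (σ i + a + (a + b))}.ncard ≤ 2 := by
  have ha : 0 < a := by omega
  have tt : ∀ j k, j ≠ k → σ j + a ≤ σ k ∨ σ k + a ≤ σ j := by
    intro j k hjk
    have h := @hσ (j, true) (k, true) (by simpa using hjk)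
    simp only [taskInterval, if_true] at h
    exact ico_sep ha ha h
  have tf : ∀ j k, σ j + a ≤ σ k + a + (a + b) ∨ σ k + a + (a + b) + b ≤ σ j := by
    intro j k
    have h := @hσ (j, true) (k, false) (by simp)
    simp only [taskInterval, if_true, Bool.false_eq_true, if_false] at h
    exact ico_sep ha hb h
  by_contra hc
  push Not at hc
  obtain ⟨⟨j, p⟩, ⟨k, q⟩, ⟨l, r⟩, ⟨_, h1⟩, ⟨_, h2⟩, ⟨_, h3⟩, h12, h13, h23⟩ :=
    (Set.two_lt_ncard_iff (Set.toFinite _)).1 hc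
  have tjk := tt j k
  have tjl := tt j l
  have tkl := tt k l
  have f1 := tf j k
  have f2 := tf j l
  have f3 := tf k j
  have f4 := tf k l
  have f5 := tf l j
  have f6 := tf l k
  clear tt tf hc hσ
  cases p <;> cases q <;> cases r <;>
    simp only [taskInterval, if_true, Bool.false_eq_true, if_false] at h1 h2 h3 <;>
    simp only [ne_eq, Prod.mk.injEq, and_true, and_false, reduceCtorEq, not_false_eq_true]
      at h12 h13 h23 <;>
    have g1 := ico_sub (by assumption) h1 <;>
    have g2 := ico_sub (by assumption) h2 <;>
    have g3 := ico_sub (by assumption) h3 <;>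
    clear h1 h2 h3 <;>
    simp only [ne_eq, *, not_false_eq_true, forall_const] at tjk tjl tkl <;>
    grind
end

section
/- Consider n coupled tasks with first sub-task of processing time a, idle time L strictly less than a + b, and second sub-task of processing time b, where a, b, L are positive natural numbers. In any valid schedule, for every task i, at most one sub-task interval of another task is contained in the idle interval [σ(i)+a, σ(i)+a+L) of task i. -/
theorem ico_disj_aux {x y c d : ℕ} (hc : 0 < c) (hd : 0 < d)
    (h : Disjoint (Set.Ico x (x + c)) (Set.Ico y (y + d))) : x + c ≤ y ∨ y + d ≤ x := by
  rw [Set.disjoint_left] at h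
  by_contra hcon
  have h1 := @h (max x y)
  simp only [Set.mem_Ico] at h1
  omega

theorem ico_sub_aux {x c u v : ℕ} (hc : 0 < c)
    (h : Set.Ico x (x + c) ⊆ Set.Ico u v) : u ≤ x ∧ x + c ≤ v := by
  have h1 := @h x
  have h2 := @h (x + c - 1)
  simp only [Set.mem_Ico] at h1 h2
  omega

/-- with `a, b, L` positive and `L < a + b`, in any valid schedule at most one
sub-task interval of another task is contained in the idle interval
`[σ i + a, σ i + a + L)` of any task `i`. -/
theorem stmt_1 (n a b L : ℕ) (ha : 0 < a) (hb : 0 < b) (hL : 0 < L) (hLab : L < a + b)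
    (σ : Fin n → ℕ) (hσ : ValidSchedule n a b L σ) (i : Fin n) :
    {q : Fin n × Bool | q.1 ≠ i ∧
      taskInterval n a b L σ q ⊆ Set.Ico (σ i + a) (σ i + a + L)}.ncard ≤ 1 := by
  rw [Set.ncard_le_one (Set.toFinite _)]
  rintro ⟨j, p⟩ ⟨_, hj⟩ ⟨k, q⟩ ⟨_, hk⟩
  by_contra hne
  have hd := hσ hne
  have key : j ≠ k → (σ j + a ≤ σ k ∨ σ k + a ≤ σ j) ∧ (σ j + b ≤ σ k ∨ σ k + b ≤ σ j) := by
    intro hjk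
    have e1 := @hσ (j, true) (k, true) (by simp [hjk])
    have e2 := @hσ (j, false) (k, false) (by simp [hjk])
    simp only [taskInterval, if_true, Bool.false_eq_true, if_false] at e1 e2
    have e1 := ico_disj_aux ha ha e1
    have e2 := ico_disj_aux hb hb e2
    omega
  cases p <;> cases q <;>
    simp only [taskInterval, if_true, Bool.false_eq_true, if_false] at hj hk hd
  · have hj := ico_sub_aux hb hj
    have hk := ico_sub_aux hb hk
    have := key (by rintro rfl; exact hne rfl)
    omega
  · have hj := ico_sub_aux hb hj
    have hk := ico_sub_aux ha hk
    have := ico_disj_aux hb ha hd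
    omega
  · have hj := ico_sub_aux ha hj
    have hk := ico_sub_aux hb hk
    have := ico_disj_aux ha hb hd
    omega
  · have hj := ico_sub_aux ha hj
    have hk := ico_sub_aux ha hk
    have := key (by rintro rfl; exact hne rfl)
    omega
end

section
/- Let a, b be natural numbers with 0 < b < a and set L = a + b. Let G_c be a simple compatibility graph on n tasks. For every path partition P of G_c, there exists a valid schedule σ of the n coupled tasks whose makespan equals n(a+b) + Σ_{p∈P} w(p), where w(p) = a if the path p has exactly one edge and w(p) = a + b otherwise. -/
/-- A partition of the vertices of a simple graph `G` into vertex-disjoint paths,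
each path being recorded as a nonempty duplicate-free list of vertices whose
consecutive elements are adjacent in `G` (a single vertex is a path of length 0). -/
structure PathPartition {V : Type} [Fintype V] [DecidableEq V] (G : SimpleGraph V) where
  paths : Finset (List V)
  ne_nil : ∀ p ∈ paths, p ≠ []
  nodup : ∀ p ∈ paths, p.Nodup
  chain : ∀ p ∈ paths, p.Chain' G.Adj
  disj : ∀ p ∈ paths, ∀ q ∈ paths, p ≠ q → ∀ v, v ∈ p → v ∉ q
  cover : ∀ v : V, ∃ p ∈ paths, v ∈ p

/-- The weight of a path: `a` if the path has exactly one edge (two vertices),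
`a + b` otherwise. -/
def pathWeight {V : Type} (a b : ℕ) (p : List V) : ℕ :=
  if p.length = 2 then a else a + b

/-- Starting time of a sub-task. -/
def subStart (n a L : ℕ) (σ : Fin n → ℕ) (q : Fin n × Bool) : ℕ :=
  if q.2 then σ q.1 else σ q.1 + a + L

/-- A schedule is valid (w.r.t. the compatibility graph `G`) when the `2n` sub-task
intervals are pairwise disjoint and any sub-task of a task `j` starting within the idle
interval of another task `i` requires `i` and `j` to be compatible, i.e. adjacent in `G`. -/
def CompatValidSchedule (n a b L : ℕ) (G : SimpleGraph (Fin n)) (σ : Fin n → ℕ) : Prop :=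
  (Pairwise fun q r : Fin n × Bool =>
    Disjoint (taskInterval n a b L σ q) (taskInterval n a b L σ r)) ∧
  ∀ i j : Fin n, ∀ s : Bool, j ≠ i →
    subStart n a L σ (j, s) ∈ Set.Ico (σ i + a) (σ i + a + L) → G.Adj i j

def PairOK (a b x y : ℕ) (A : Prop) : Prop :=
  (x + a ≤ y ∨ y + a ≤ x) ∧ (x + a ≤ y + a + (a + b) ∨ y + a + (a + b) + b ≤ x) ∧
  (y + a ≤ x + a + (a + b) ∨ x + a + (a + b) + b ≤ y) ∧ (x + b ≤ y ∨ y + b ≤ x) ∧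
  ((x + a ≤ y ∧ y < x + a + (a + b)) → A) ∧
  ((x + a ≤ y + a + (a + b) ∧ y + a + (a + b) < x + a + (a + b)) → A)

def locStart {n : ℕ} (a b : ℕ) (p : List (Fin n)) (i : Fin n) : ℕ :=
  if p.length = 2 then p.idxOf i * a else p.idxOf i * (a + b)

lemma chain_adj {n : ℕ} {G : SimpleGraph (Fin n)} {p : List (Fin n)}
    (hc : p.IsChain G.Adj) {i j : Fin n} (hi : i ∈ p) (hj : j ∈ p)
    (h : p.idxOf j = p.idxOf i + 1) : G.Adj i j := by
  have h1 := List.idxOf_lt_length_of_mem hi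
  have h2 := List.idxOf_lt_length_of_mem hj
  have h3 := List.isChain_iff_getElem.1 hc (p.idxOf i) (by omega)
  have h4 : p[p.idxOf i + 1]'(by omega) = j := by
    have := List.getElem_idxOf h2
    simp only [h] at this
    exact this
  rw [h4, List.getElem_idxOf h1] at h3
  exact h3

lemma loc_ok {n a b : ℕ} (hb : 0 < b) (hba : b < a) {G : SimpleGraph (Fin n)}
    {p : List (Fin n)} (hc : p.IsChain G.Adj) {i j : Fin n} (hi : i ∈ p) (hj : j ∈ p)
    (hij : i ≠ j) (T : ℕ) :
    PairOK a b (T + locStart a b p i) (T + locStart a b p j) (G.Adj i j) := by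
  have hne : p.idxOf i ≠ p.idxOf j := fun h => hij ((List.idxOf_inj hi).1 h)
  have h1 := List.idxOf_lt_length_of_mem hi
  have h2 := List.idxOf_lt_length_of_mem hj
  have A1 : p.idxOf j = p.idxOf i + 1 → G.Adj i j := chain_adj hc hi hj
  have A2 : p.idxOf i = p.idxOf j + 1 → G.Adj i j := fun h => (chain_adj hc hj hi h).symm
  unfold PairOK locStart
  generalize p.idxOf i = k at *
  generalize p.idxOf j = m at *
  generalize p.length = l at *
  generalize G.Adj i j = A at *
  by_cases hadj : A
  · simp only [hadj, implies_true, and_true]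
    split_ifs with hl
    · subst hl
      obtain ⟨rfl, rfl⟩ | ⟨rfl, rfl⟩ : (k = 0 ∧ m = 1) ∨ (k = 1 ∧ m = 0) := by omega
      · omega
      · omega
    · obtain h | h : k < m ∨ m < k := by omega
      · obtain ⟨d, rfl⟩ := Nat.exists_eq_add_of_lt h
        rw [show (k + d + 1) * (a + b) = k * (a + b) + d * (a + b) + (a + b) by ring]
        rcases d with _ | d
        · simp only [Nat.zero_mul]; generalize k * (a+b) = K; omega
        · rw [Nat.succ_mul]; generalize k * (a+b) = K; generalize d * (a+b) = D; omega
      · obtain ⟨d, rfl⟩ := Nat.exists_eq_add_of_lt h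
        rw [show (m + d + 1) * (a + b) = m * (a + b) + d * (a + b) + (a + b) by ring]
        rcases d with _ | d
        · simp only [Nat.zero_mul]; generalize m * (a+b) = K; omega
        · rw [Nat.succ_mul]; generalize m * (a+b) = K; generalize d * (a+b) = D; omega
  · simp only [hadj, imp_false] at *
    split_ifs with hl
    · omega
    · obtain h | h : k + 2 ≤ m ∨ m + 2 ≤ k := by omega
      · obtain ⟨d, rfl⟩ := Nat.exists_eq_add_of_le h
        rw [show (k + 2 + d) * (a + b) = k * (a + b) + d * (a + b) + 2 * (a + b) by ring]
        generalize k * (a+b) = K; generalize d * (a+b) = D; omega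
      · obtain ⟨d, rfl⟩ := Nat.exists_eq_add_of_le h
        rw [show (m + 2 + d) * (a + b) = m * (a + b) + d * (a + b) + 2 * (a + b) by ring]
        generalize m * (a+b) = K; generalize d * (a+b) = D; omega

def blk {n : ℕ} (a b : ℕ) (p : List (Fin n)) : ℕ := p.length * (a + b) + pathWeight a b p

lemma loc_le {n a b : ℕ} {p : List (Fin n)} {i : Fin n} (hi : i ∈ p) :
    locStart a b p i + a + (a + b) + b ≤ blk a b p := by
  have h1 := List.idxOf_lt_length_of_mem hi
  unfold locStart blk pathWeight
  split_ifs with hl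
  · rw [hl] at h1 ⊢
    have : p.idxOf i * a ≤ 1 * a := Nat.mul_le_mul_right _ (by omega)
    omega
  · have : (p.idxOf i + 1) * (a + b) ≤ p.length * (a + b) := Nat.mul_le_mul_right _ (by omega)
    rw [Nat.succ_mul] at this
    omega

lemma loc_last {n a b : ℕ} {p : List (Fin n)} (hp : p ≠ []) (hd : p.Nodup) :
    ∃ i ∈ p, locStart a b p i + a + (a + b) + b = blk a b p := by
  have hl0 : 0 < p.length := List.length_pos_iff.2 hp
  refine ⟨p[p.length - 1], List.getElem_mem _, ?_⟩
  unfold locStart blk pathWeight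
  rw [hd.idxOf_getElem]
  split_ifs with hl
  · rw [hl]; omega
  · obtain ⟨k, hk⟩ : ∃ k, p.length = k + 1 := ⟨p.length - 1, by omega⟩
    rw [hk, Nat.add_sub_cancel, Nat.succ_mul]
    omega

lemma build {n a b : ℕ} (hb : 0 < b) (hba : b < a) (G : SimpleGraph (Fin n))
    (P : PathPartition G) (S : Finset (List (Fin n))) : S ⊆ P.paths →
    ∃ σ : Fin n → ℕ,
      (∀ i j, i ≠ j → (∃ p ∈ S, i ∈ p) → (∃ p ∈ S, j ∈ p) → PairOK a b (σ i) (σ j) (G.Adj i j)) ∧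
      (∀ i, (∃ p ∈ S, i ∈ p) → σ i + a + (a + b) + b ≤ ∑ p ∈ S, blk a b p) ∧
      ((∑ p ∈ S, blk a b p) = 0 ∨ ∃ i, σ i + a + (a + b) + b = ∑ p ∈ S, blk a b p) := by
  classical
  induction S using Finset.induction_on with
  | empty => intro _; exact ⟨fun _ => 0, by simp, by simp, by simp⟩
  | insert p S hpS ih =>
    intro hS
    obtain ⟨σ, h1, h2, -⟩ := ih (fun x hx => hS (Finset.mem_insert_of_mem hx))
    have hp : p ∈ P.paths := hS (Finset.mem_insert_self _ _)
    have cov : ∀ i, i ∉ p → (∃ q ∈ insert p S, i ∈ q) → ∃ q ∈ S, i ∈ q := by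
      rintro i hi ⟨q, hq, hiq⟩
      rcases Finset.mem_insert.1 hq with rfl | hq
      · exact absurd hiq hi
      · exact ⟨q, hq, hiq⟩
    rw [Finset.sum_insert hpS]
    generalize ∑ p ∈ S, blk a b p = T at *
    refine ⟨fun i => if i ∈ p then T + locStart a b p i else σ i, ?_, ?_, ?_⟩
    · intro i j hij hi hj
      by_cases hip : i ∈ p <;> by_cases hjp : j ∈ p <;> simp only [hip, hjp, if_true, if_false]
      · exact loc_ok hb hba (P.chain p hp) hip hjp hij T
      · have := h2 j (cov j hjp hj)
        unfold PairOK
        refine ⟨?_, ?_, ?_, ?_, fun _ => ?_, fun _ => ?_⟩ <;> omega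
      · have := h2 i (cov i hip hi)
        unfold PairOK
        refine ⟨?_, ?_, ?_, ?_, fun _ => ?_, fun _ => ?_⟩ <;> omega
      · exact h1 i j hij (cov i hip hi) (cov j hjp hj)
    · intro i hi
      by_cases hip : i ∈ p <;> simp only [hip, if_true, if_false]
      · have := loc_le (a := a) (b := b) hip
        omega
      · have := h2 i (cov i hip hi)
        omega
    · right
      obtain ⟨i, hi, h⟩ := loc_last (a := a) (b := b) (P.ne_nil p hp) (P.nodup p hp)
      refine ⟨i, ?_⟩
      simp only [hi, if_true]
      omega

lemma sum_len {n : ℕ} (G : SimpleGraph (Fin n)) (P : PathPartition G) :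
    ∑ p ∈ P.paths, p.length = n := by
  classical
  have h : P.paths.biUnion List.toFinset = Finset.univ := by
    ext v
    simpa using P.cover v
  have h2 := Finset.card_biUnion (s := P.paths) (t := List.toFinset) (by
    intro p hp q hq hpq
    rw [Function.onFun, Finset.disjoint_left]
    intro v hv hv'
    exact P.disj p hp q hq hpq v (by simpa using hv) (by simpa using hv'))
  rw [h, Finset.card_univ, Fintype.card_fin] at h2
  refine Eq.trans ?_ h2.symm
  exact Finset.sum_congr rfl fun p hp => (List.toFinset_card_of_nodup (P.nodup p hp)).symm

/-- with `0 < b < a` and `L = a + b`, for every path partition `P` of the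
compatibility graph `G`, there is a valid schedule whose makespan is exactly
`n(a+b) + Σ_{p ∈ P} w(p)`. -/
theorem stmt_2 (n a b : ℕ) (hb : 0 < b) (hba : b < a)
    (G : SimpleGraph (Fin n)) (P : PathPartition G) :
    ∃ σ : Fin n → ℕ, CompatValidSchedule n a b (a + b) G σ ∧
      (Finset.univ.sup fun i => σ i + a + (a + b) + b) =
        n * (a + b) + ∑ p ∈ P.paths, pathWeight a b p := by
  obtain ⟨σ, h1, h2, h3⟩ := build hb hba G P P.paths (fun _ h => h)
  have hs : ∑ p ∈ P.paths, blk a b p = n * (a + b) + ∑ p ∈ P.paths, pathWeight a b p := by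
    unfold blk
    rw [Finset.sum_add_distrib, ← Finset.sum_mul, sum_len]
  rw [hs] at h2 h3
  have ok : ∀ i j, i ≠ j → PairOK a b (σ i) (σ j) (G.Adj i j) :=
    fun i j h => h1 i j h (P.cover i) (P.cover j)
  refine ⟨σ, ⟨?_, ?_⟩, ?_⟩
  · rintro ⟨i, s⟩ ⟨j, t⟩ hne
    rw [Set.disjoint_left]
    intro x hx hy
    by_cases hij : i = j
    · subst hij
      cases s <;> cases t <;> simp [taskInterval] at hx hy hne <;> omega
    · obtain ⟨o1, o2, o3, o4, -, -⟩ := ok i j hij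
      cases s <;> cases t <;> simp [taskInterval] at hx hy <;> omega
  · intro i j s hji hx
    obtain ⟨-, -, -, -, o5, o6⟩ := ok i j hji.symm
    cases s <;> simp only [subStart, Set.mem_Ico, if_true, if_false, Bool.false_eq_true] at hx
    · exact o6 hx
    · exact o5 hx
  · apply le_antisymm
    · exact Finset.sup_le fun i _ => h2 i (P.cover i)
    · rcases h3 with h | ⟨i, hi⟩
      · rw [h]; exact Nat.zero_le _
      · rw [← hi]
        exact Finset.le_sup (f := fun i => σ i + a + (a + b) + b) (Finset.mem_univ i)
end

section
/- Let a, b be natural numbers with 0 < b < a and set L = a + b. Let G_c be a simple compatibility graph on n tasks. For every valid schedule σ of the n coupled tasks, there exists a path partition P of G_c such that n(a+b) + Σ_{p∈P} w(p) ≤ C_max(σ), where w(p) = a if the path p has exactly one edge and w(p) = a + b otherwise. -/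
/-- Relation between tasks in the same run. -/
def RunRel {n : ℕ} (a b : ℕ) (G : SimpleGraph (Fin n)) (σ : Fin n → ℕ) (i j : Fin n) : Prop :=
  G.Adj i j ∧ σ i + a ≤ σ j ∧ σ j ≤ σ i + (a + b)

/-- Refined weight of the head path. -/
def refW {n : ℕ} (a b : ℕ) (σ : Fin n → ℕ) : List (Fin n) → ℕ
  | [x, z] => σ z - σ x
  | _ => a + b

theorem pair_rel {n a b : ℕ} {G : SimpleGraph (Fin n)} {σ : Fin n → ℕ} (hb : 0 < b) (hba : b < a)
    (hσ : CompatValidSchedule n a b (a + b) G σ) (i j : Fin n) (hij : i ≠ j) (hle : σ i ≤ σ j) :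
    RunRel a b G σ i j ∨ σ i + 2 * (a + b) ≤ σ j := by
  obtain ⟨h1, h2⟩ := hσ
  have e1 := @h1 (i, true) (j, true) (by simp [hij])
  have e2 := @h1 (i, false) (j, true) (by simp)
  have h3 := h2 i j true hij.symm
  simp only [taskInterval, subStart, Set.disjoint_left, Set.mem_Ico, if_true, Bool.false_eq_true,
    if_false] at e1 e2 h3
  have f1 := @e1 (σ j)
  have f2 := @e2 (σ j)
  have f3 := @e2 (σ i + a + (a + b))
  by_cases hc : σ i + 2 * (a + b) ≤ σ j
  · exact Or.inr hc
  · left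
    refine ⟨h3 ⟨by omega, by omega⟩, by omega, by omega⟩

theorem build_s3 {n a b : ℕ} {G : SimpleGraph (Fin n)} {σ : Fin n → ℕ} (hb : 0 < b) (hba : b < a)
    (M : ℕ) (l : List (Fin n)) : ∀ x : Fin n,
    (x :: l).Pairwise (fun i j => RunRel a b G σ i j ∨ σ i + 2 * (a + b) ≤ σ j) →
    (∀ v ∈ x :: l, σ v + 2 * (a + b) ≤ M) →
    ∃ (p : List (Fin n)) (ps : List (List (Fin n))),
      (x :: p) ++ ps.flatten = x :: l ∧ (∀ q ∈ ps, q ≠ []) ∧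
      (∀ q ∈ (x :: p) :: ps, q.IsChain (RunRel a b G σ)) ∧
      (l.length + 1) * (a + b) + refW a b σ (x :: p) + (ps.map (pathWeight a b)).sum + σ x ≤ M := by
  induction l with
  | nil =>
    intro x _ hM
    refine ⟨[], [], by simp, by simp, by simp, ?_⟩
    have := hM x (by simp)
    simp [refW]; omega
  | cons z l ih =>
    intro x hp hM
    rw [List.pairwise_cons] at hp
    obtain ⟨p, ps, hf, hne, hch, hw⟩ := ih z hp.2 (fun v hv => hM v (List.mem_cons_of_mem _ hv))
    have hwz : pathWeight a b (z :: p) ≤ refW a b σ (z :: p) := by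
      have := hch (z :: p) (by simp)
      match p, this with
      | [], _ => simp [pathWeight, refW]
      | [y], h =>
        simp only [List.isChain_cons_cons] at h
        have := h.1.2
        simp [pathWeight, refW]; omega
      | _ :: _ :: _, _ => simp [pathWeight, refW]
    have hlen : ((z :: l).length + 1) * (a + b) = (l.length + 1) * (a + b) + (a + b) := by
      simp [List.length_cons]; ring
    rw [hlen]
    rcases hp.1 z (by simp) with hr | hr
    · refine ⟨z :: p, ps, by simpa using hf, hne, ?_, ?_⟩
      · intro q hq
        rcases List.mem_cons.1 hq with rfl | hq
        · exact List.isChain_cons_cons.2 ⟨hr, hch _ (by simp)⟩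
        · exact hch q (by simp [hq])
      · have hc := hch (z :: p) (by simp)
        match p, hc, hf, hw with
        | [], _, _, hw =>
          have := hr.2
          simp only [refW] at hw ⊢; omega
        | y :: p', hc, hf, hw =>
          have hy : y ∈ z :: l := by
            rw [← hf]; simp
          have h1 := (List.isChain_cons_cons.1 hc).1.2
          have h2 := hr.2
          have h3 : RunRel a b G σ x y ∨ σ x + 2 * (a + b) ≤ σ y := hp.1 y hy
          have h4 : σ x + 2 * (a + b) ≤ σ y := by
            rcases h3 with h3 | h3
            · have := h3.2; omega
            · exact h3
          cases p' with
          | nil => simp only [refW] at hw ⊢; omega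
          | cons _ _ => simp only [refW] at hw ⊢; omega
    · refine ⟨[], (z :: p) :: ps, by simpa using hf, ?_, ?_, ?_⟩
      · intro q hq
        rcases List.mem_cons.1 hq with rfl | hq
        · simp
        · exact hne q hq
      · intro q hq
        rcases List.mem_cons.1 hq with rfl | hq
        · simp
        · exact hch q hq
      · simp only [List.map_cons, List.sum_cons]
        have : refW a b σ [x] = a + b := rfl
        omega

theorem stmt_3 (n a b : ℕ) (hb : 0 < b) (hba : b < a)
    (G : SimpleGraph (Fin n)) (σ : Fin n → ℕ)
    (hσ : CompatValidSchedule n a b (a + b) G σ) :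
    ∃ P : PathPartition G,
      n * (a + b) + ∑ p ∈ P.paths, pathWeight a b p ≤
        Finset.univ.sup fun i => σ i + a + (a + b) + b := by
  set M := Finset.univ.sup fun i => σ i + a + (a + b) + b with hMdef
  have hM : ∀ v, σ v + 2 * (a + b) ≤ M := by
    intro v
    have : σ v + a + (a + b) + b ≤ M :=
      Finset.le_sup (f := fun i => σ i + a + (a + b) + b) (Finset.mem_univ v)
    omega
  suffices H : ∃ ps : List (List (Fin n)), ps.flatten.Nodup ∧ (∀ v, v ∈ ps.flatten) ∧
      (∀ q ∈ ps, q ≠ []) ∧ (∀ q ∈ ps, q.IsChain (RunRel a b G σ)) ∧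
      n * (a + b) + (ps.map (pathWeight a b)).sum ≤ M by
    obtain ⟨ps, hnd, hcov, hne, hch, hw⟩ := H
    have hnd2 := List.nodup_flatten.1 hnd
    have hpsnd : ps.Nodup := by
      refine List.Pairwise.imp_of_mem ?_ hnd2.2
      rintro p q hp hq hd rfl
      obtain ⟨v, hv⟩ := List.exists_mem_of_ne_nil _ (hne p hp)
      exact hd hv hv
    refine ⟨⟨ps.toFinset, ?_, ?_, ?_, ?_, ?_⟩, ?_⟩
    · intro p hp; exact hne p (by simpa using hp)
    · intro p hp; exact hnd2.1 p (by simpa using hp)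
    · intro p hp; exact (hch p (by simpa using hp)).imp (fun _ _ h => h.1)
    · intro p hp q hq hpq v hv hv'
      have hsy : Std.Symm (fun p q : List (Fin n) => p ≠ q → List.Disjoint p q) :=
        ⟨fun _ _ h hne => (h hne.symm).symm⟩
      have hpw : ps.Pairwise (fun p q => p ≠ q → List.Disjoint p q) := by
        refine List.Pairwise.imp ?_ hnd2.2
        intro p q h _
        exact h
      have := List.Pairwise.forall_of_forall (fun x _ h => absurd rfl h) hpw
        (List.mem_toFinset.1 hp) (List.mem_toFinset.1 hq) hpq
      exact this hv hv'
    · intro v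
      obtain ⟨p, hp, hv⟩ := List.mem_flatten.1 (hcov v)
      exact ⟨p, by simpa using hp, hv⟩
    · rw [List.sum_toFinset _ hpsnd]; exact hw
  set l := (List.finRange n).mergeSort (fun i j => decide (σ i ≤ σ j)) with hl
  have hperm : l.Perm (List.finRange n) := List.mergeSort_perm _ _
  have hnd : l.Nodup := hperm.nodup_iff.2 (List.nodup_finRange n)
  have hmem : ∀ v, v ∈ l := fun v => hperm.mem_iff.2 (List.mem_finRange v)
  have hlen : l.length = n := by simpa using hperm.length_eq
  have hs : l.Pairwise (fun i j => σ i ≤ σ j) := by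
    have := List.pairwise_mergeSort (le := fun i j : Fin n => decide (σ i ≤ σ j))
      (by intro x y z; simp; omega) (by intro x y; simp; omega) (List.finRange n)
    exact this.imp (by simp)
  have hR : l.Pairwise (fun i j => RunRel a b G σ i j ∨ σ i + 2 * (a + b) ≤ σ j) :=
    (List.Pairwise.and hs hnd).imp (fun h => pair_rel hb hba hσ _ _ h.2 h.1)
  clear_value l
  cases l with
  | nil =>
    refine ⟨[], by simp, by simpa using hmem, by simp, by simp, ?_⟩
    simp at hlen; subst hlen; simp
  | cons x l =>
    obtain ⟨p, ps, hf, hne, hch, hw⟩ := build_s3 hb hba M l x hR (fun v _ => hM v)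
    have hff : ((x :: p) :: ps).flatten = x :: l := by simpa using hf
    refine ⟨(x :: p) :: ps, by rw [hff]; exact hnd, by rw [hff]; exact hmem, ?_, hch, ?_⟩
    · intro q hq
      rcases List.mem_cons.1 hq with rfl | hq
      · simp
      · exact hne q hq
    · have hwz : pathWeight a b (x :: p) ≤ refW a b σ (x :: p) := by
        have := hch (x :: p) (by simp)
        match p, this with
        | [], _ => simp [pathWeight, refW]
        | [y], h =>
          simp only [List.isChain_cons_cons] at h
          have := h.1.2
          simp [pathWeight, refW]; omega
        | _ :: _ :: _, _ => simp [pathWeight, refW]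
      have : l.length + 1 = n := by simpa using hlen
      rw [this] at hw
      simp only [List.map_cons, List.sum_cons]
      omega
end

section
/- Let a, b be natural numbers with 0 < b < a, and let G be a finite simple graph on n ≥ 3 vertices. Then OPT(G) = (n+1)(a+b) if and only if G contains a Hamiltonian path. -/
/-- The SLDPC-cost of a path partition of a graph on `n` vertices:
`n(a+b) + Σ_{p ∈ P} w(p)`. -/
def SLDPCcost {V : Type} [Fintype V] [DecidableEq V] (a b : ℕ) {G : SimpleGraph V}
    (P : PathPartition G) : ℕ :=
  Fintype.card V * (a + b) + ∑ p ∈ P.paths, pathWeight a b p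

/-- The minimum SLDPC-cost over all path partitions of `G`. -/
noncomputable def OPT {V : Type} [Fintype V] [DecidableEq V] (a b : ℕ)
    (G : SimpleGraph V) : ℕ :=
  sInf {c : ℕ | ∃ P : PathPartition G, SLDPCcost a b P = c}

theorem cost_aux {V : Type} [Fintype V] [DecidableEq V] (a b : ℕ)
    (hba : b < a) (G : SimpleGraph V) (hn : 3 ≤ Fintype.card V) (P : PathPartition G) :
    (∑ p ∈ P.paths, pathWeight a b p = a + b ∧
      ∃ l : List V, l.Nodup ∧ l.Chain' G.Adj ∧ ∀ v : V, v ∈ l) ∨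
    a + b < ∑ p ∈ P.paths, pathWeight a b p := by
  have h1 : P.paths.card * a ≤ ∑ p ∈ P.paths, pathWeight a b p := by
    rw [← smul_eq_mul]
    apply Finset.card_nsmul_le_sum
    intro p _
    unfold pathWeight
    split_ifs <;> omega
  rcases Nat.lt_or_ge 1 P.paths.card with h | h
  · right
    nlinarith
  · left
    have hne : P.paths.card ≠ 0 := by
      intro h0
      have : Nonempty V := Fintype.card_pos_iff.mp (by omega)
      obtain ⟨p, hp, _⟩ := P.cover this.some
      rw [Finset.card_eq_zero] at h0
      simp [h0] at hp
    obtain ⟨l, hl⟩ := Finset.card_eq_one.mp (by omega : P.paths.card = 1)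
    have hmem : l ∈ P.paths := by simp [hl]
    have hcov : ∀ v : V, v ∈ l := by
      intro v
      obtain ⟨p, hp, hv⟩ := P.cover v
      rw [hl, Finset.mem_singleton] at hp
      exact hp ▸ hv
    have hlen : Fintype.card V ≤ l.length := by
      have : (Finset.univ : Finset V) ⊆ l.toFinset := fun v _ => by simp [hcov v]
      exact (Finset.card_le_card this).trans l.toFinset_card_le
    refine ⟨?_, l, P.nodup l hmem, P.chain l hmem, hcov⟩
    rw [hl, Finset.sum_singleton, pathWeight, if_neg (by omega)]

/-- with `0 < b < a` and a graph `G` on `n ≥ 3` vertices,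
`OPT(G) = (n+1)(a+b)` if and only if `G` contains a Hamiltonian path (a path visiting
every vertex exactly once, encoded as a duplicate-free list of adjacent vertices
containing every vertex). -/
theorem stmt_6 {V : Type} [Fintype V] [DecidableEq V] (a b : ℕ) (hb : 0 < b)
    (hba : b < a) (G : SimpleGraph V) (hn : 3 ≤ Fintype.card V) :
    OPT a b G = (Fintype.card V + 1) * (a + b) ↔
      ∃ l : List V, l.Nodup ∧ l.Chain' G.Adj ∧ ∀ v : V, v ∈ l := by
  constructor
  · intro h
    have hne : {c : ℕ | ∃ P : PathPartition G, SLDPCcost a b P = c}.Nonempty := by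
      rw [Set.nonempty_iff_ne_empty]
      intro h0
      rw [OPT, h0, Nat.sInf_empty] at h
      have : 0 < (Fintype.card V + 1) * (a + b) := by positivity
      omega
    obtain ⟨P, hP⟩ := Nat.sInf_mem hne
    change SLDPCcost a b P = OPT a b G at hP
    rw [h, SLDPCcost, add_mul, one_mul] at hP
    rcases cost_aux a b hba G hn P with h1 | h1
    · exact h1.2
    · omega
  · rintro ⟨l, hnd, hch, hcov⟩
    have hl0 : l ≠ [] := by
      rintro rfl
      have : Nonempty V := Fintype.card_pos_iff.mp (by omega)
      simpa using hcov this.some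
    let P : PathPartition G :=
      { paths := {l}
        ne_nil := by simpa using hl0
        nodup := by simpa using hnd
        chain := by simpa using hch
        disj := by
          intro p hp q hq hpq
          rw [Finset.mem_singleton] at hp hq
          exact absurd (hp.trans hq.symm) hpq
        cover := fun v => ⟨l, by simp, hcov v⟩ }
    have hP : SLDPCcost a b P = (Fintype.card V + 1) * (a + b) := by
      have hle : ∑ p ∈ P.paths, pathWeight a b p ≤ a + b := by
        simp only [P, Finset.sum_singleton, pathWeight]
        split_ifs <;> omega
      rw [SLDPCcost, add_mul, one_mul]
      rcases cost_aux a b hba G hn P with h1 | h1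
      · rw [h1.1]
      · omega
    apply le_antisymm
    · exact Nat.sInf_le ⟨P, hP⟩
    · refine le_csInf (s := {c : ℕ | ∃ P : PathPartition G, SLDPCcost a b P = c}) ⟨_, P, rfl⟩ ?_
      rintro c ⟨Q, rfl⟩
      rw [SLDPCcost, add_mul, one_mul]
      rcases cost_aux a b hba G hn Q with h1 | h1
      · rw [h1.1]
      · omega
end

section
/- Let p be a positive natural number and consider n coupled tasks with both sub-tasks of processing time p and idle time L = 2p, with compatibility graph G_c. If the vertex set of G_c can be partitioned into vertex-disjoint triangles (so 3 divides n and each triangle's three vertices are pairwise adjacent in G_c), then there exists a valid schedule of the n tasks with makespan exactly 2pn, i.e., with no idle time on the processor. -/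
theorem aux_index (n : ℕ) (G : SimpleGraph (Fin n))
    (T : Finset (Finset (Fin n)))
    (hcard : ∀ t ∈ T, t.card = 3)
    (hadj : ∀ t ∈ T, ∀ u ∈ t, ∀ v ∈ t, u ≠ v → G.Adj u v)
    (hpart : ∀ v : Fin n, ∃! t, t ∈ T ∧ v ∈ t) :
    ∃ k r : Fin n → ℕ, (∀ v, r v < 3) ∧ (∀ v, 3 * (k v + 1) ≤ n) ∧
      (∀ u v, k u = k v → r u = r v → u = v) ∧
      (∀ u v, k u = k v → u ≠ v → G.Adj u v) ∧
      (0 < n → ∃ v, 3 * (k v + 1) = n ∧ r v = 2) := by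
  have hn : n = 3 * T.card := by
    have h1 : T.biUnion id = Finset.univ := by
      ext v
      obtain ⟨t, ⟨h1, h2⟩, -⟩ := hpart v
      simp only [Finset.mem_biUnion, Finset.mem_univ, iff_true]
      exact ⟨t, h1, h2⟩
    have h2 := Finset.card_biUnion (s := T) (t := id) (by
      intro a ha b hb hab
      rw [Function.onFun, Finset.disjoint_left]
      intro v hva hvb
      exact hab ((hpart v).unique ⟨ha, hva⟩ ⟨hb, hvb⟩))
    rw [h1, Finset.sum_congr rfl (fun t ht => by simpa using hcard t ht)] at h2
    simp at h2
    omega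
  have hg : ∀ t : Finset (Fin n), ∃ g : Fin n → ℕ, t ∈ T →
      (∀ v ∈ t, g v < 3) ∧ ∀ u ∈ t, ∀ v ∈ t, g u = g v → u = v := by
    intro t
    by_cases ht : t ∈ T
    · let e := t.equivFinOfCardEq (hcard t ht)
      refine ⟨fun v => if h : v ∈ t then (e ⟨v, h⟩ : ℕ) else 0, fun _ => ⟨?_, ?_⟩⟩
      · intro v hv
        simp [hv]
      · intro u hu v hv h
        simp only [hu, hv, dite_true] at h
        have := e.injective (Fin.ext h)
        simpa using this
    · exact ⟨fun _ => 0, fun h => absurd h ht⟩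
  choose g hg using hg
  choose τ hτ using fun v => (hpart v).exists
  let e := T.equivFin
  let k : Fin n → ℕ := fun v => (e ⟨τ v, (hτ v).1⟩ : ℕ)
  let r : Fin n → ℕ := fun v => g (τ v) v
  have hk : ∀ v, k v < T.card := fun v => (e ⟨τ v, (hτ v).1⟩).2
  have hr : ∀ v, r v < 3 := fun v => (hg _ (hτ v).1).1 v (hτ v).2
  have hkτ : ∀ u v, k u = k v → τ u = τ v := by
    intro u v h
    have := e.injective (Fin.ext h)
    simpa using this
  have hinj : ∀ u v, k u = k v → r u = r v → u = v := by
    intro u v h h'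
    have ht := hkτ u v h
    refine (hg _ (hτ v).1).2 u (ht ▸ (hτ u).2) v (hτ v).2 ?_
    have h2 : g (τ u) u = g (τ v) v := h'
    rwa [ht] at h2
  refine ⟨k, r, hr, fun v => by have := hk v; omega, hinj, ?_, ?_⟩
  · intro u v h hne
    have ht := hkτ u v h
    exact hadj _ (hτ v).1 u (ht ▸ (hτ u).2) v (hτ v).2 hne
  · intro hpos
    let f : Fin n → Fin n := fun v => ⟨3 * k v + r v, by have := hk v; have := hr v; omega⟩
    have hf : Function.Injective f := by
      intro u v h
      have h' : 3 * k u + r u = 3 * k v + r v := congrArg Fin.val h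
      have := hr u
      have := hr v
      exact hinj u v (by omega) (by omega)
    obtain ⟨v, hv⟩ := (Finite.injective_iff_surjective.1 hf) ⟨n - 1, by omega⟩
    have h' : 3 * k v + r v = n - 1 := congrArg Fin.val hv
    have := hr v
    exact ⟨v, by omega, by omega⟩

theorem aux_slot (p a b x : ℕ) (h1 : p * a ≤ x) (h2 : x < p * b + p) : a ≤ b := by
  by_contra h
  have : p * (b + 1) ≤ p * a := Nat.mul_le_mul_left p (by omega)
  rw [mul_add] at this
  omega

/-- coupled tasks with both sub-tasks of processing time `p > 0` and idle
time `L = 2p`. If the vertex set of the compatibility graph `G` can be partitioned into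
vertex-disjoint triangles (each vertex lies in exactly one triangle of the collection
`T`, each triangle having three pairwise adjacent vertices), then there is a valid
schedule with makespan exactly `2pn`, i.e. with no idle time on the processor. -/
theorem stmt_8 (n p : ℕ) (hp : 0 < p) (G : SimpleGraph (Fin n))
    (T : Finset (Finset (Fin n)))
    (hcard : ∀ t ∈ T, t.card = 3)
    (hadj : ∀ t ∈ T, ∀ u ∈ t, ∀ v ∈ t, u ≠ v → G.Adj u v)
    (hpart : ∀ v : Fin n, ∃! t, t ∈ T ∧ v ∈ t) :
    ∃ σ : Fin n → ℕ, CompatValidSchedule n p p (2 * p) G σ ∧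
      (Finset.univ.sup fun i => σ i + p + 2 * p + p) = 2 * p * n := by
  obtain ⟨k, r, hr, hk, hinj, hG, hlast⟩ := aux_index n G T hcard hadj hpart
  let m : Fin n × Bool → ℕ := fun q => 6 * k q.1 + r q.1 + if q.2 then 0 else 3
  let σ : Fin n → ℕ := fun v => p * (6 * k v + r v)
  have hS : ∀ q, subStart n p (2 * p) σ q = p * m q := by
    rintro ⟨v, s⟩
    cases s <;> simp [subStart, m, σ] <;> ring
  have hI : ∀ q, taskInterval n p p (2 * p) σ q = Set.Ico (p * m q) (p * m q + p) := by
    intro q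
    rw [← hS]
    obtain ⟨v, s⟩ := q
    cases s <;> simp [subStart, taskInterval]
  refine ⟨σ, ⟨?_, ?_⟩, ?_⟩
  · intro q q' hne
    rw [hI, hI, Set.disjoint_left]
    rintro x ⟨h1, h2⟩ ⟨h3, h4⟩
    have e1 := aux_slot p _ _ x h1 h4
    have e2 := aux_slot p _ _ x h3 h2
    apply hne
    obtain ⟨v, s⟩ := q
    obtain ⟨v', s'⟩ := q'
    have a1 := hr v
    have a2 := hr v'
    have a3 := hinj v v'
    cases s <;> cases s' <;> simp [m] at e1 e2 ⊢ <;> first | omega | exact a3 (by omega) (by omega)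
  · intro i j s hne h
    rw [hS] at h
    obtain ⟨h1, h2⟩ := h
    have e1 := aux_slot p (6 * k i + r i + 1) (m (j, s)) (p * m (j, s))
      (by simp only [σ] at h1; rw [mul_add p _ 1]; omega) (by omega)
    have e2 := aux_slot p (m (j, s)) (6 * k i + r i + 2) (p * m (j, s)) le_rfl
      (by simp only [σ] at h2; rw [mul_add p _ 2]; omega)
    have a1 := hr i
    have a2 := hr j
    refine hG i j ?_ hne.symm
    cases s <;> simp [m] at e1 e2 <;> omega
  · have hσ : ∀ v, σ v + p + 2 * p + p = p * (6 * k v + r v + 4) := by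
      intro v
      simp only [σ]
      ring
    simp only [hσ]
    have hc : 2 * p * n = p * (2 * n) := by ring
    rw [hc]
    apply le_antisymm
    · refine Finset.sup_le fun v _ => Nat.mul_le_mul_left p ?_
      have := hr v
      have := hk v
      omega
    · rcases Nat.eq_zero_or_pos n with h0 | h0
      · simp [h0]
      · obtain ⟨v, h1, h2⟩ := hlast h0
        refine le_trans (Nat.mul_le_mul_left p ?_)
          (Finset.le_sup (f := fun v => p * (6 * k v + r v + 4)) (Finset.mem_univ v))
        omega
end

section
/- Let a, b be positive real numbers with b < a, and let G be a finite simple graph on n vertices with matching number ν (the maximum cardinality of a matching of G). Define the heuristic cost C^h = n(a+b) + a·ν + (a+b)·(n − 2ν). Then 2(a+b)·C^h ≤ (3a+2b)·OPT(G); equivalently, the matching-based schedule is a ((3a+2b)/(2a+2b))-approximation. -/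
/-- The (real-valued) weight of a path: `a` if the path has exactly one edge
(two vertices), `a + b` otherwise. -/
noncomputable def pathWeightR {V : Type} (a b : ℝ) (p : List V) : ℝ :=
  if p.length = 2 then a else a + b

/-- The (real-valued) SLDPC-cost of a path partition of a graph on `n` vertices:
`n(a+b) + Σ_{p ∈ P} w(p)`. -/
noncomputable def SLDPCcostR {V : Type} [Fintype V] [DecidableEq V] (a b : ℝ)
    {G : SimpleGraph V} (P : PathPartition G) : ℝ :=
  (Fintype.card V : ℝ) * (a + b) + ∑ p ∈ P.paths, pathWeightR a b p

/-- The minimum (real-valued) SLDPC-cost over all path partitions of `G`. -/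
noncomputable def OPTR {V : Type} [Fintype V] [DecidableEq V] (a b : ℝ)
    (G : SimpleGraph V) : ℝ :=
  sInf {c : ℝ | ∃ P : PathPartition G, SLDPCcostR a b P = c}

/-- A finite set of edges of `G` is a matching when its edges are pairwise
vertex-disjoint. -/
def IsMatchingSet {V : Type} [DecidableEq V] (G : SimpleGraph V)
    (M : Finset (Sym2 V)) : Prop :=
  (∀ e ∈ M, e ∈ G.edgeSet) ∧ ∀ e ∈ M, ∀ f ∈ M, e ≠ f → ∀ v : V, v ∈ e → v ∉ f

def pathMatch {V : Type} [DecidableEq V] : List V → Finset (Sym2 V)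
  | x :: y :: l => insert s(x, y) (pathMatch l)
  | _ => ∅

theorem pathMatch_mem {V : Type} [DecidableEq V] : ∀ (l : List V) (e : Sym2 V),
    e ∈ pathMatch l → ∀ v ∈ e, v ∈ l
  | [], e, h, v, hv => by simp [pathMatch] at h
  | [x], e, h, v, hv => by simp [pathMatch] at h
  | x :: y :: l, e, h, v, hv => by
    simp only [pathMatch, Finset.mem_insert] at h
    rcases h with rfl | h
    · simp only [Sym2.mem_iff] at hv
      rcases hv with rfl | rfl <;> simp
    · have := pathMatch_mem l e h v hv
      simp [this]

theorem pathMatch_spec {V : Type} [DecidableEq V] (G : SimpleGraph V) : ∀ (l : List V),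
    l.Nodup → l.IsChain G.Adj →
      IsMatchingSet G (pathMatch l) ∧ (pathMatch l).card = l.length / 2
  | [], _, _ => by simp [pathMatch, IsMatchingSet]
  | [x], _, _ => by simp [pathMatch, IsMatchingSet]
  | x :: y :: l, hn, hc => by
    simp only [List.nodup_cons, List.mem_cons, not_or] at hn
    obtain ⟨⟨hxy, hxl⟩, hyl, hl⟩ := hn
    have hadj : G.Adj x y := by
      rw [List.isChain_cons_cons] at hc
      exact hc.1
    have hc' : l.IsChain G.Adj := hc.tail.tail
    obtain ⟨⟨h1, h2⟩, h3⟩ := pathMatch_spec G l hl hc'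
    have hd : ∀ f ∈ pathMatch l, ∀ v ∈ s(x, y), v ∉ f := by
      intro f hf v hv hvf
      have := pathMatch_mem l f hf v hvf
      simp only [Sym2.mem_iff] at hv
      rcases hv with rfl | rfl
      · exact hxl this
      · exact hyl this
    refine ⟨⟨?_, ?_⟩, ?_⟩
    · intro e he
      simp only [pathMatch, Finset.mem_insert] at he
      rcases he with rfl | he
      · exact hadj
      · exact h1 e he
    · intro e he f hf hef v hve hvf
      simp only [pathMatch, Finset.mem_insert] at he hf
      rcases he with rfl | he <;> rcases hf with rfl | hf
      · exact hef rfl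
      · exact hd f hf v hve hvf
      · exact hd e he v hvf hve
      · exact h2 e he f hf hef v hve hvf
    · have : s(x, y) ∉ pathMatch l := fun h => hd _ h x (by simp) (by simp)
      simp only [pathMatch, Finset.card_insert_of_notMem this, h3, List.length_cons]
      omega

theorem sum_half_le {V : Type} [Fintype V] [DecidableEq V] (G : SimpleGraph V) (ν : ℕ)
    (hν : IsGreatest {k : ℕ | ∃ M : Finset (Sym2 V), IsMatchingSet G M ∧ M.card = k} ν)
    (P : PathPartition G) : ∑ p ∈ P.paths, p.length / 2 ≤ ν := by
  have hs : ∀ p ∈ P.paths, _ := fun p hp => pathMatch_spec G p (P.nodup p hp) (P.chain p hp)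
  have key : ∀ p ∈ P.paths, ∀ q ∈ P.paths, p ≠ q → ∀ e ∈ pathMatch p, ∀ f ∈ pathMatch q,
      ∀ v ∈ e, v ∉ f := fun p hp q hq hpq e he f hf v hve hvf =>
    P.disj p hp q hq hpq v (pathMatch_mem p e he v hve) (pathMatch_mem q f hf v hvf)
  apply hν.2
  refine ⟨P.paths.biUnion pathMatch, ⟨?_, ?_⟩, ?_⟩
  · intro e he
    obtain ⟨p, hp, he⟩ := Finset.mem_biUnion.1 he
    exact (hs p hp).1.1 e he
  · intro e he f hf hef v hve hvf
    obtain ⟨p, hp, he⟩ := Finset.mem_biUnion.1 he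
    obtain ⟨q, hq, hf⟩ := Finset.mem_biUnion.1 hf
    by_cases hpq : p = q
    · subst hpq
      exact (hs p hp).1.2 e he f hf hef v hve hvf
    · exact key p hp q hq hpq e he f hf v hve hvf
  · rw [Finset.card_biUnion]
    · exact Finset.sum_congr rfl fun p hp => (hs p hp).2
    · intro p hp q hq hpq
      rw [Function.onFun, Finset.disjoint_left]
      intro e he hf
      induction e using Sym2.ind with
      | _ x y => exact key p hp q hq hpq _ he _ hf x (by simp) (by simp)

theorem sum_length {V : Type} [Fintype V] [DecidableEq V] (G : SimpleGraph V)
    (P : PathPartition G) : ∑ p ∈ P.paths, p.length = Fintype.card V := by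
  have : (Finset.univ : Finset V) = P.paths.biUnion List.toFinset := by
    ext v
    simpa using P.cover v
  rw [← Finset.card_univ, this, Finset.card_biUnion]
  · exact Finset.sum_congr rfl fun p hp => (List.toFinset_card_of_nodup (P.nodup p hp)).symm
  · intro p hp q hq hpq
    rw [Function.onFun, Finset.disjoint_left]
    intro v h1 h2
    exact P.disj p hp q hq hpq v (by simpa using h1) (by simpa using h2)

theorem path_ineq (a b : ℝ) (hb : 0 < b) (hba : b < a) (k : ℕ) (hk : k ≠ 0) :
    2 * (a + b) * (2 * (a + b) * k - (a + 2 * b) * ((k / 2 : ℕ) : ℝ)) ≤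
      (3 * a + 2 * b) * ((a + b) * k + if k = 2 then a else a + b) := by
  have ha : 0 < a := hb.trans hba
  have h1 := mul_pos ha hb
  have h2 := mul_pos ha ha
  have h3 := mul_pos hb hb
  obtain ⟨m, rfl | rfl⟩ := Nat.even_or_odd' k
  · rw [Nat.mul_div_cancel_left m (by norm_num)]
    split_ifs with h
    · have : m = 1 := by omega
      subst this
      push_cast
      nlinarith
    · push_cast
      nlinarith
  · rw [if_neg (by omega), show (2 * m + 1) / 2 = m by omega]
    push_cast
    nlinarith

def trivPartition {V : Type} [Fintype V] [DecidableEq V] (G : SimpleGraph V) :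
    PathPartition G where
  paths := Finset.univ.image fun v => [v]
  ne_nil := by simp
  nodup := by simp
  chain := by
    intro p hp
    obtain ⟨v, -, rfl⟩ := Finset.mem_image.1 hp
    exact List.isChain_singleton v
  disj := by
    intro p hp q hq hpq v h1 h2
    obtain ⟨x, -, rfl⟩ := Finset.mem_image.1 hp
    obtain ⟨y, -, rfl⟩ := Finset.mem_image.1 hq
    simp only [List.mem_singleton] at h1 h2
    exact hpq (by rw [← h1, ← h2])
  cover := by simp


/-- let `0 < b < a` be reals and `G` a graph on `n` vertices with matching
number `ν`. With the heuristic cost `C^h = n(a+b) + a·ν + (a+b)(n - 2ν)` of the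
matching-based schedule, we have `2(a+b)·C^h ≤ (3a+2b)·OPT(G)`: the matching-based
schedule is a `(3a+2b)/(2a+2b)`-approximation. -/
theorem stmt_10 {V : Type} [Fintype V] [DecidableEq V] (a b : ℝ) (hb : 0 < b)
    (hba : b < a) (G : SimpleGraph V) (ν : ℕ)
    (hν : IsGreatest {k : ℕ | ∃ M : Finset (Sym2 V), IsMatchingSet G M ∧ M.card = k} ν) :
    2 * (a + b) *
        ((Fintype.card V : ℝ) * (a + b) + a * ν + (a + b) * ((Fintype.card V : ℝ) - 2 * ν))
      ≤ (3 * a + 2 * b) * OPTR a b G := by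
  have hpos : 0 < 3 * a + 2 * b := by linarith
  rw [← div_le_iff₀' hpos]
  refine le_csInf ⟨_, trivPartition G, rfl⟩ ?_
  rintro c ⟨P, rfl⟩
  rw [div_le_iff₀' hpos]
  have hn : (Fintype.card V : ℝ) = ∑ p ∈ P.paths, (p.length : ℝ) := by
    rw [← sum_length G P]; push_cast; rfl
  have hm : ∑ p ∈ P.paths, ((p.length / 2 : ℕ) : ℝ) ≤ ν := by
    exact_mod_cast sum_half_le G ν hν P
  have hsum := Finset.sum_le_sum (s := P.paths) fun (p : List V) hp =>
    path_ineq a b hb hba p.length (by simpa using P.ne_nil p hp)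
  rw [← Finset.mul_sum, ← Finset.mul_sum, Finset.sum_sub_distrib, Finset.sum_add_distrib,
    ← Finset.mul_sum, ← Finset.mul_sum, ← Finset.mul_sum, ← hn] at hsum
  unfold SLDPCcostR pathWeightR
  have h4 : 2 * (a + b) * ((a + 2 * b) * ∑ p ∈ P.paths, ((p.length / 2 : ℕ) : ℝ)) ≤
      2 * (a + b) * ((a + 2 * b) * ν) := by
    have : 0 ≤ a + b := by linarith
    have : 0 ≤ a + 2 * b := by linarith
    gcongr
  linarith
end

section
/- Let a, b be positive real numbers (or natural numbers) with b < a, and let G be a finite simple graph on n vertices. If P1 is a path partition of G of minimum cardinality (i.e., minimizing the number of paths among all path partitions of G), then its SLDPC-cost satisfies a·(n(a+b) + Σ_{p∈P1} w(p)) ≤ (a+b)·OPT(G); in other words, a minimum-cardinality path cover is an ((a+b)/a)-approximate solution for Min-SLDPC. -/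
/-- let `0 < b < a` be reals and `G` a graph on `n` vertices. If `P1` is a
path partition of `G` of minimum cardinality (a minimum disjoint-path cover), then
`a · SLDPC-cost(P1) ≤ (a+b) · OPT(G)`: a minimum-cardinality path cover is an
`(a+b)/a`-approximate solution for Min-SLDPC. -/
theorem stmt_12 {V : Type} [Fintype V] [DecidableEq V] (a b : ℝ) (hb : 0 < b)
    (hba : b < a) (G : SimpleGraph V) (P1 : PathPartition G)
    (hmin : ∀ P' : PathPartition G, P1.paths.card ≤ P'.paths.card) :
    a * SLDPCcostR a b P1 ≤ (a + b) * OPTR a b G := by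
  have hab : 0 < a + b := by linarith
  have ha : 0 < a := by linarith
  have key : a * SLDPCcostR a b P1 / (a + b) ≤ OPTR a b G := by
    unfold OPTR
    refine le_csInf ⟨_, P1, rfl⟩ ?_
    rintro c ⟨P, rfl⟩
    rw [div_le_iff₀ hab]
    have h1 : ∑ p ∈ P1.paths, pathWeightR a b p ≤ (P1.paths.card : ℝ) * (a + b) := by
      rw [← nsmul_eq_mul]
      apply Finset.sum_le_card_nsmul
      intro p _
      unfold pathWeightR
      split_ifs <;> linarith
    have h2 : (P.paths.card : ℝ) * a ≤ ∑ p ∈ P.paths, pathWeightR a b p := by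
      rw [← nsmul_eq_mul]
      apply Finset.card_nsmul_le_sum
      intro p _
      unfold pathWeightR
      split_ifs <;> linarith
    have h3 : (P1.paths.card : ℝ) ≤ P.paths.card := by exact_mod_cast hmin P
    have hn : (0 : ℝ) ≤ Fintype.card V := Nat.cast_nonneg _
    unfold SLDPCcostR
    generalize (Fintype.card V : ℝ) = n at *
    have e1 := mul_le_mul_of_nonneg_left h1 ha.le
    have e2 := mul_le_mul_of_nonneg_right h2 hab.le
    have e3 := mul_le_mul_of_nonneg_right h3 (mul_pos ha hab).le
    have e4 : 0 ≤ n * (a + b) * b := by positivity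
    nlinarith
  rw [div_le_iff₀ hab] at key
  linarith
end

section
/- For all positive real numbers a and b, min( (a+b)/a , (3a+2b)/(2(a+b)) ) ≤ (1+√3)/2, with equality if and only if a = (1+√3)·b. -/
/-- for all positive reals `a` and `b`,
`min((a+b)/a, (3a+2b)/(2(a+b))) ≤ (1+√3)/2`, with equality if and only if
`a = (1+√3)·b`. -/
theorem stmt_14 (a b : ℝ) (ha : 0 < a) (hb : 0 < b) :
    min ((a + b) / a) ((3 * a + 2 * b) / (2 * (a + b))) ≤ (1 + Real.sqrt 3) / 2 ∧
      (min ((a + b) / a) ((3 * a + 2 * b) / (2 * (a + b))) = (1 + Real.sqrt 3) / 2 ↔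
        a = (1 + Real.sqrt 3) * b) := by
  have hs : Real.sqrt 3 * Real.sqrt 3 = 3 := Real.mul_self_sqrt (by norm_num)
  have hs0 : 0 ≤ Real.sqrt 3 := Real.sqrt_nonneg 3
  generalize Real.sqrt 3 = s at *
  have h1 : 1 < s := by nlinarith
  have h2 : s < 2 := by nlinarith
  rcases lt_trichotomy a ((1 + s) * b) with h | h | h
  · have hg : (3 * a + 2 * b) / (2 * (a + b)) < (1 + s) / 2 := by
      rw [div_lt_div_iff₀ (by positivity) (by norm_num)]
      have h3 := mul_lt_mul_of_pos_left h (sub_pos.2 h2)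
      have h4 : (2 - s) * ((1 + s) * b) = (s - 1) * b := by linear_combination (-b) * hs
      nlinarith
    have hm := lt_of_le_of_lt (min_le_right ((a + b) / a) _) hg
    exact ⟨hm.le, fun e => absurd e hm.ne, fun e => absurd e h.ne⟩
  · have hf : (a + b) / a = (1 + s) / 2 := by
      rw [div_eq_div_iff ha.ne' (by norm_num), h]
      linear_combination (-b) * hs
    have hg : (3 * a + 2 * b) / (2 * (a + b)) = (1 + s) / 2 := by
      rw [div_eq_div_iff (by positivity) (by norm_num), h]
      linear_combination (-2 * b) * hs
    rw [hf, hg, min_self]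
    exact ⟨le_rfl, fun _ => h, fun _ => rfl⟩
  · have hf : (a + b) / a < (1 + s) / 2 := by
      rw [div_lt_div_iff₀ ha (by norm_num)]
      have h3 := mul_lt_mul_of_pos_left h (sub_pos.2 h1)
      have h4 : (s - 1) * ((1 + s) * b) = 2 * b := by linear_combination b * hs
      nlinarith
    have hm := lt_of_le_of_lt (min_le_left _ ((3 * a + 2 * b) / (2 * (a + b)))) hf
    exact ⟨hm.le, fun e => absurd e hm.ne, fun e => absurd e h.ne'⟩
end

section
/- Let a, b be natural numbers with 0 < b < a and set L = a + b. Let G_c be a simple compatibility graph on n ≥ 3 tasks. The minimum makespan over all valid schedules of the n coupled tasks equals n(a+b) + min over all path partitions P of G_c of Σ_{p∈P} w(p), where w(p) = a if the path p has exactly one edge and w(p) = a + b otherwise. -/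
def RR {V : Type} (a b : ℕ) (G : SimpleGraph V) (σ : V → ℕ) (u v : V) : Prop :=
  (σ u + a ≤ σ v ∧ σ v ≤ σ u + a + b ∧ G.Adj u v) ∨ σ u + 2 * (a + b) ≤ σ v

theorem valid_imp {n a b : ℕ} (hb : 0 < b) (hba : b < a) {G : SimpleGraph (Fin n)} {σ : Fin n → ℕ}
    (h : CompatValidSchedule n a b (a + b) G σ) (i j : Fin n) (hij : i ≠ j) (hle : σ i ≤ σ j) :
    RR a b G σ i j := by
  obtain ⟨h1, h2⟩ := h
  have e1 := @h1 (i, true) (j, true) (by simp [hij])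
  have e2 := @h1 (i, false) (j, true) (by simp)
  have e3 := h2 i j true hij.symm
  simp only [taskInterval, subStart, Set.Ico_disjoint_Ico, Set.mem_Ico, if_true, Bool.false_eq_true,
    if_false] at e1 e2 e3
  by_cases h : σ j < σ i + a + (a + b)
  · left
    have := e3 ⟨by omega, h⟩
    exact ⟨by omega, by omega, this⟩
  · right
    omega

theorem valid_of {n a b : ℕ} (hb : 0 < b) (hba : b < a) {G : SimpleGraph (Fin n)} {σ : Fin n → ℕ}
    (h : ∀ i j, i ≠ j → σ i ≤ σ j → RR a b G σ i j) :
    CompatValidSchedule n a b (a + b) G σ := by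
  have key : ∀ i j, i ≠ j → RR a b G σ i j ∨ RR a b G σ j i := by
    intro i j hij
    rcases le_total (σ i) (σ j) with h' | h'
    · exact Or.inl (h i j hij h')
    · exact Or.inr (h j i hij.symm h')
  constructor
  · rintro ⟨i, s⟩ ⟨j, t⟩ hne
    by_cases hij : i = j
    · subst hij
      cases s <;> cases t <;> simp [taskInterval, Set.Ico_disjoint_Ico] at hne ⊢ <;> omega
    · have := key i j hij
      unfold RR at this
      cases s <;> cases t <;> simp only [taskInterval, Set.Ico_disjoint_Ico, if_true,
        Bool.false_eq_true, if_false] <;> omega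
  · intro i j s hij hm
    rcases key i j hij.symm with (h' | h') | (h' | h')
    · exact h'.2.2
    · exfalso
      cases s <;> simp [subStart] at hm <;> omega
    · exact h'.2.2.symm
    · exfalso
      cases s <;> simp [subStart] at hm <;> omega

def pcost {V : Type} (a b : ℕ) (p : List V) : ℕ := p.length * (a + b) + pathWeight a b p

theorem pcost_le {V : Type} (a b : ℕ) (p : List V) : pcost a b p ≤ (p.length + 1) * (a + b) := by
  unfold pcost pathWeight
  split_ifs <;> rw [add_mul] <;> omega

theorem sum_pcost {V : Type} (a b : ℕ) (L : List (List V)) :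
    (L.map (pcost a b)).sum = L.flatten.length * (a + b) + (L.map (pathWeight a b)).sum := by
  induction L with
  | nil => simp
  | cons p L ih =>
    simp only [List.map_cons, List.sum_cons, ih, List.flatten_cons, List.length_append, pcost]
    ring

theorem decomp {V : Type} {a b : ℕ} (hb : 0 < b) (hba : b < a) {G : SimpleGraph V} {σ : V → ℕ}
    (M : ℕ) : ∀ (k : ℕ) (x : V) (l : List V), l.length ≤ k → (x :: l).Pairwise (RR a b G σ) →
    (∀ v ∈ x :: l, σ v + 2 * (a + b) ≤ M) →
    ∃ (p : List V) (L : List (List V)), ((x :: p) :: L).flatten = x :: l ∧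
      (∀ q ∈ (x :: p) :: L, q ≠ [] ∧ q.IsChain G.Adj) ∧
      (((p.length + 2) * (a + b) + (L.map (pcost a b)).sum + σ x ≤ M) ∨
       (∃ y ∈ l, σ y < σ x + (a + b) ∧
        pcost a b (x :: p) + (L.map (pcost a b)).sum + σ x ≤ M)) := by
  intro k
  induction k using Nat.strong_induction_on with
  | _ k ih =>
  intro x l hk hp hM
  have fin1 : ∀ (x : V) (p : List V) (L : List (List V)) (l : List V),
      (((p.length + 2) * (a + b) + (L.map (pcost a b)).sum + σ x ≤ M) ∨
       (∃ y ∈ l, σ y < σ x + (a + b) ∧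
        pcost a b (x :: p) + (L.map (pcost a b)).sum + σ x ≤ M)) →
      (((x :: p) :: L).map (pcost a b)).sum + σ x ≤ M := by
    intro x p L l h
    simp only [List.map_cons, List.sum_cons]
    rcases h with h | ⟨_, _, _, h⟩
    · have := pcost_le a b (x :: p)
      simp only [List.length_cons] at this
      linarith
    · exact h
  match l, hk, hp, hM with
  | [], hk, hp, hM =>
    refine ⟨[], [], by simp, by simp, Or.inl ?_⟩
    have := hM x (by simp)
    simp; omega
  | y :: l, hk, hp, hM =>
    simp only [List.length_cons] at hk
    have hp' := List.pairwise_cons.1 hp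
    have hp2 := List.pairwise_cons.1 hp'.2
    have hxy := hp'.1 y (by simp)
    obtain ⟨p, L, h1, h2, h3⟩ := ih (k-1) (by omega) y l (by omega) hp'.2
      (fun v hv => hM v (List.mem_cons_of_mem _ hv))
    rcases hxy with ⟨c1, c2, c3⟩ | hfar
    · by_cases hlt : σ y < σ x + (a + b)
      · have hpc : pcost a b [x, y] = 2 * (a + b) + a := by simp [pcost, pathWeight]
        match l, hk, hp, hM, hp', hp2 with
        | [], hk, hp, hM, hp', hp2 =>
          refine ⟨[y], [], by simp, by simp [c3], Or.inr ⟨y, by simp, hlt, ?_⟩⟩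
          have := hM y (by simp)
          rw [hpc]; simp; omega
        | z :: l, hk, hp, hM, hp', hp2 =>
          simp only [List.length_cons] at hk
          obtain ⟨p, L, h1, h2, h3⟩ := ih (k-2) (by omega) z l (by omega) hp2.2
            (fun v hv => hM v (List.mem_cons_of_mem _ (List.mem_cons_of_mem _ hv)))
          have h4 := fin1 _ _ _ _ h3
          have hxz := hp'.1 z (by simp)
          have hyz := hp2.1 z (by simp)
          refine ⟨[y], (z :: p) :: L, ?_, ?_, Or.inr ⟨y, by simp, hlt, ?_⟩⟩
          · rw [List.flatten_cons, h1]; simp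
          · intro q hq
            rcases List.mem_cons.1 hq with rfl | hq
            · simp [c3]
            · exact h2 q hq
          · rw [hpc]
            unfold RR at hxz hyz
            omega
      · refine ⟨y :: p, L, ?_, ?_, Or.inl ?_⟩
        · rw [← h1]; simp
        · intro q hq
          rcases List.mem_cons.1 hq with rfl | hq
          · refine ⟨by simp, ?_⟩
            rw [List.isChain_cons_cons]
            exact ⟨c3, (h2 (y :: p) (by simp)).2⟩
          · exact h2 q (List.mem_cons_of_mem _ hq)
        · rcases h3 with h3 | ⟨z, hz, h4, _⟩
          · simp only [List.length_cons]
            have : (p.length + 1 + 2) * (a + b) = (p.length + 2) * (a + b) + (a + b) := by ring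
            omega
          · have hxz := hp'.1 z (by simp [hz])
            have hyz := hp2.1 z hz
            unfold RR at hxz hyz
            omega
    · have h4 := fin1 _ _ _ _ h3
      refine ⟨[], (y :: p) :: L, ?_, ?_, Or.inl ?_⟩
      · rw [List.flatten_cons, h1]; simp
      · intro q hq
        rcases List.mem_cons.1 hq with rfl | hq
        · simp
        · exact h2 q hq
      · simp only [List.length_nil]
        omega

theorem to_part {n a b : ℕ} (hb : 0 < b) (hba : b < a) (hn : 3 ≤ n) {G : SimpleGraph (Fin n)}
    {σ : Fin n → ℕ} (h : CompatValidSchedule n a b (a + b) G σ) (M : ℕ)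
    (hM : ∀ i, σ i + 2 * (a + b) ≤ M) :
    ∃ P : PathPartition G, n * (a + b) + ∑ p ∈ P.paths, pathWeight a b p ≤ M := by
  classical
  let l := (List.finRange n).insertionSort (fun u v => σ u ≤ σ v)
  have hperm : l.Perm (List.finRange n) := List.perm_insertionSort _ _
  have hnd : l.Nodup := hperm.nodup_iff.2 (List.nodup_finRange n)
  have hlen : l.length = n := by rw [hperm.length_eq]; simp
  have hmem : ∀ v, v ∈ l := fun v => hperm.mem_iff.2 (List.mem_finRange v)
  haveI : Std.Total (fun u v : Fin n => σ u ≤ σ v) := ⟨fun u v => le_total _ _⟩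
  haveI : IsTrans (Fin n) (fun u v : Fin n => σ u ≤ σ v) := ⟨fun u v w h h' => le_trans h h'⟩
  have hs : l.Pairwise (fun u v => σ u ≤ σ v) := List.pairwise_insertionSort _ _
  have hR : l.Pairwise (RR a b G σ) :=
    (hs.and hnd).imp (fun {u v} huv => valid_imp hb hba h u v huv.2 huv.1)
  clear_value l
  match l, hlen with
  | [], hlen => simp at hlen; omega
  | x :: l, hlen =>
    obtain ⟨p, L, h1, h2, h3⟩ := decomp hb hba M l.length x l le_rfl hR (fun v _ => hM v)
    have hc : (((x :: p) :: L).map (pcost a b)).sum ≤ M := by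
      simp only [List.map_cons, List.sum_cons]
      rcases h3 with h | ⟨_, _, _, h⟩
      · have := pcost_le a b (x :: p)
        simp only [List.length_cons] at this
        linarith
      · omega
    generalize hLL : (x :: p) :: L = LL at *
    rw [sum_pcost, h1, hlen] at hc
    rw [← h1] at hnd hmem
    obtain ⟨g1, g2⟩ := List.nodup_flatten.1 hnd
    have g3 : LL.Nodup := by
      refine List.Pairwise.imp_of_mem ?_ g2
      rintro u v hu hv hd rfl
      obtain ⟨w, hw⟩ := List.exists_mem_of_ne_nil u (h2 u hu).1
      exact hd hw hw
    refine ⟨⟨LL.toFinset, ?_, ?_, ?_, ?_, ?_⟩, ?_⟩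
    · intro p hp; exact (h2 p (List.mem_toFinset.1 hp)).1
    · intro p hp; exact g1 p (List.mem_toFinset.1 hp)
    · intro p hp; exact (h2 p (List.mem_toFinset.1 hp)).2
    · intro p hp q hq hne v hv hv'
      haveI : Std.Symm (fun u v : List (Fin n) => u.Disjoint v) := ⟨fun u v h => h.symm⟩
      exact g2.forall (List.mem_toFinset.1 hp) (List.mem_toFinset.1 hq) hne hv hv'
    · intro v
      obtain ⟨p, hp, hv⟩ := List.mem_flatten.1 (hmem v)
      exact ⟨p, List.mem_toFinset.2 hp, hv⟩
    · rw [List.sum_toFinset _ g3]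
      exact hc

theorem build_s15 {V : Type} [DecidableEq V] {a b : ℕ} (hb : 0 < b) (hba : b < a) {G : SimpleGraph V}
    (L : List (List V)) (hL : ∀ p ∈ L, p.IsChain G.Adj) (hnd : L.flatten.Nodup) :
    ∃ σ : V → ℕ, (∀ v ∈ L.flatten, σ v + 2 * (a + b) ≤ (L.map (pcost a b)).sum) ∧
      ∀ u ∈ L.flatten, ∀ v ∈ L.flatten, u ≠ v → σ u ≤ σ v → RR a b G σ u v := by
  induction L with
  | nil => exact ⟨fun _ => 0, by simp, by simp⟩
  | cons p L ih =>
    rw [List.flatten_cons] at hnd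
    obtain ⟨n1, n2, n3⟩ := List.nodup_append'.1 hnd
    obtain ⟨σ, s1, s2⟩ := ih (fun q hq => hL q (List.mem_cons_of_mem _ hq)) n2
    have hch := hL p (by simp)
    let s := if p.length = 2 then a else a + b
    have hs1 : a ≤ s := by dsimp only [s]; split_ifs <;> omega
    have hs2 : s ≤ a + b := by dsimp only [s]; split_ifs <;> omega
    have hcost : ∀ i, i < p.length → i * s + 2 * (a + b) ≤ pcost a b p := by
      intro i hi
      dsimp only [s]
      unfold pcost pathWeight
      split_ifs with h
      · rw [h] at hi ⊢
        have : i * a ≤ 1 * a := Nat.mul_le_mul_right _ (by omega)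
        omega
      · have : (i + 1) * (a + b) ≤ p.length * (a + b) := Nat.mul_le_mul_right _ hi
        rw [add_mul] at this
        omega
    have hpair : ∀ i j, (hij : i < j) → (hj : j < p.length) →
        ((i * s + a ≤ j * s ∧ j * s ≤ i * s + a + b ∧ G.Adj (p[i]'(hij.trans hj)) (p[j])) ∨
          i * s + 2 * (a + b) ≤ j * s) := by
      intro i j hij hj
      obtain ⟨e, rfl⟩ := Nat.exists_eq_add_of_lt hij
      rcases Nat.eq_zero_or_pos e with rfl | he
      · left
        have := List.isChain_iff_getElem.1 hch i hj
        have h2 : (i + 0 + 1) * s = i * s + s := by ring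
        exact ⟨by omega, by omega, this⟩
      · right
        have : s = a + b := by
          dsimp only [s]; rw [if_neg]; omega
        rw [this]
        have : (i + 2) * (a + b) ≤ (i + e + 1) * (a + b) := Nat.mul_le_mul_right _ (by omega)
        rw [add_mul i 2] at this
        exact this
    refine ⟨fun v => if v ∈ p then p.idxOf v * s else pcost a b p + σ v, ?_, ?_⟩
    · intro v hv
      simp only [List.map_cons, List.sum_cons]
      split_ifs with h
      · have := hcost _ (List.idxOf_lt_length_iff.2 h)
        omega
      · have : v ∈ L.flatten := by
          rw [List.flatten_cons, List.mem_append] at hv; tauto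
        have := s1 v this
        omega
    · intro u hu v hv huv
      rw [List.flatten_cons, List.mem_append] at hu hv
      unfold RR
      by_cases hup : u ∈ p <;> by_cases hvp : v ∈ p <;> simp only [hup, hvp, if_true, if_false]
      · intro hle
        have iu := List.idxOf_lt_length_iff.2 hup
        have iv := List.idxOf_lt_length_iff.2 hvp
        have hlt : p.idxOf u < p.idxOf v := by
          rcases lt_trichotomy (p.idxOf u) (p.idxOf v) with h | h | h
          · exact h
          · exact absurd ((List.idxOf_inj hup).1 h) huv
          · exfalso
            have : p.idxOf v * s < p.idxOf u * s := Nat.mul_lt_mul_of_pos_right h (by omega)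
            omega
        have := hpair _ _ hlt iv
        simpa using this
      · intro _
        right
        have := hcost _ (List.idxOf_lt_length_iff.2 hup)
        omega
      · intro h
        exfalso
        have := hcost _ (List.idxOf_lt_length_iff.2 hvp)
        omega
      · intro h
        have := s2 u (by tauto) v (by tauto) huv (by omega)
        unfold RR at this
        rcases this with ⟨c1, c2, c3⟩ | h
        · exact Or.inl ⟨by omega, by omega, c3⟩
        · right; omega

theorem to_sched {n a b : ℕ} (hb : 0 < b) (hba : b < a) {G : SimpleGraph (Fin n)}
    (P : PathPartition G) :
    ∃ σ : Fin n → ℕ, CompatValidSchedule n a b (a + b) G σ ∧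
      ∀ i, σ i + 2 * (a + b) ≤ n * (a + b) + ∑ p ∈ P.paths, pathWeight a b p := by
  have hnd : P.paths.toList.flatten.Nodup := by
    refine List.nodup_flatten.2 ⟨fun p hp => P.nodup p (Finset.mem_toList.1 hp), ?_⟩
    refine List.Pairwise.imp_of_mem ?_ P.paths.nodup_toList
    intro p q hp hq hne v hv hv'
    exact P.disj p (Finset.mem_toList.1 hp) q (Finset.mem_toList.1 hq) hne v hv hv'
  have hmem : ∀ v, v ∈ P.paths.toList.flatten := by
    intro v
    obtain ⟨p, hp, hv⟩ := P.cover v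
    exact List.mem_flatten.2 ⟨p, Finset.mem_toList.2 hp, hv⟩
  have hlen : P.paths.toList.flatten.length ≤ n := by
    simpa using hnd.length_le_card
  obtain ⟨σ, h1, h2⟩ := build_s15 hb hba P.paths.toList
    (fun p hp => P.chain p (Finset.mem_toList.1 hp)) hnd
  refine ⟨σ, valid_of hb hba (fun i j => h2 i (hmem i) j (hmem j)), fun i => ?_⟩
  have := h1 i (hmem i)
  rw [sum_pcost, Finset.sum_map_toList] at this
  change _ ≤ _ + Finset.sum P.paths (pathWeight a b)
  have h3 := Nat.mul_le_mul_right (a + b) hlen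
  omega

def trivPart {n : ℕ} (G : SimpleGraph (Fin n)) : PathPartition G where
  paths := Finset.univ.image (fun v => [v])
  ne_nil := by simp
  nodup := by simp
  chain := by
    intro p hp
    simp only [Finset.mem_image, Finset.mem_univ, true_and] at hp
    obtain ⟨x, rfl⟩ := hp
    exact List.isChain_singleton x
  disj := by
    intro p hp q hq hne v hv hv'
    simp only [Finset.mem_image, Finset.mem_univ, true_and] at hp hq
    obtain ⟨x, rfl⟩ := hp
    obtain ⟨y, rfl⟩ := hq
    simp at hv hv'
    subst hv; subst hv'; exact hne rfl
  cover := by simp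

/-- with `0 < b < a`, `L = a + b` and `n ≥ 3` tasks, the minimum makespan
over all valid schedules equals `n(a+b)` plus the minimum over all path partitions `P`
of the compatibility graph `G` of `Σ_{p ∈ P} w(p)`. -/
theorem stmt_15 (n a b : ℕ) (hb : 0 < b) (hba : b < a) (hn : 3 ≤ n)
    (G : SimpleGraph (Fin n)) :
    sInf {C : ℕ | ∃ σ : Fin n → ℕ, CompatValidSchedule n a b (a + b) G σ ∧
        (Finset.univ.sup fun i => σ i + a + (a + b) + b) = C} =
      n * (a + b) +
        sInf {w : ℕ | ∃ P : PathPartition G, ∑ p ∈ P.paths, pathWeight a b p = w} := by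
  apply le_antisymm
  · obtain ⟨P, hP⟩ := Nat.sInf_mem (s := {w : ℕ | ∃ P : PathPartition G,
      ∑ p ∈ P.paths, pathWeight a b p = w}) ⟨_, trivPart G, rfl⟩
    rw [← hP]
    obtain ⟨σ, h1, h2⟩ := to_sched hb hba P
    refine le_trans (Nat.sInf_le ⟨σ, h1, rfl⟩) ?_
    refine Finset.sup_le fun i _ => ?_
    have := h2 i
    omega
  · obtain ⟨σ₀, h₀, _⟩ := to_sched hb hba (trivPart G)
    obtain ⟨σ, h1, h2⟩ := Nat.sInf_mem (s := {C : ℕ | ∃ σ : Fin n → ℕ,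
      CompatValidSchedule n a b (a + b) G σ ∧
        (Finset.univ.sup fun i => σ i + a + (a + b) + b) = C}) ⟨_, σ₀, h₀, rfl⟩
    rw [← h2]
    obtain ⟨P, hP⟩ := to_part hb hba hn h1 (Finset.univ.sup fun i => σ i + a + (a + b) + b)
      (fun i => by
        have := Finset.le_sup (f := fun i => σ i + a + (a + b) + b) (Finset.mem_univ i)
        omega)
    refine le_trans ?_ hP
    apply Nat.add_le_add_left
    exact Nat.sInf_le ⟨P, rfl⟩
end
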